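/- Let x ∈ J be an element of rank k. There exists a unique idempotent c of rank k such that c·x = x; moreover this idempotent c belongs to the subalgebra ℝ[x] generated by x. -/

import Mathlib

open scoped BigOperators Classical

/-- Bare data of a (real) Jordan algebra: a bilinear product and a unit element. -/
structure JordanData (J : Type) [AddCommGroup J] [Module ℝ J] where
  mul : J →ₗ[ℝ] J →ₗ[ℝ] J
  e : J

namespace JordanData

variable {J : Type} [AddCommGroup J] [Module ℝ J] (A : JordanData J)

/-- `c` is an idempotent. -/
def IsIdem (c : J) : Prop := A.mul c c = c

/-- `c` is a primitive idempotent: a nonzero idempotent which dominates only `0` and itself. -/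
def IsPrimitive (c : J) : Prop :=
  A.IsIdem c ∧ c ≠ 0 ∧ ∀ d : J, A.IsIdem d → A.mul c d = d → d = 0 ∨ d = c

/-- A Jordan frame: a complete system of pairwise orthogonal primitive idempotents. -/
def IsFrame {m : ℕ} (c : Fin m → J) : Prop :=
  (∀ j, A.IsPrimitive (c j)) ∧ (∀ i j, i ≠ j → A.mul (c i) (c j) = 0) ∧ ∑ j, c j = A.e

end JordanData

/-- A simple Euclidean Jordan algebra of rank `rank`, together with its trace `tr`
and determinant `jdet` (characterized by their values on spectral decompositions). -/
structure EJA (J : Type) [NormedAddCommGroup J] [NormedSpace ℝ J] [FiniteDimensional ℝ J]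
    extends JordanData J where
  comm : ∀ x y : J, mul x y = mul y x
  unit_mul : ∀ x : J, mul e x = x
  jordan : ∀ x y : J, mul (mul x x) (mul x y) = mul x (mul (mul x x) y)
  tr : J →ₗ[ℝ] ℝ
  tr_posdef : ∀ x : J, x ≠ 0 → 0 < tr (mul x x)
  simple : ∀ I : Submodule ℝ J, (∀ x ∈ I, ∀ y : J, mul y x ∈ I) → I = ⊥ ∨ I = ⊤
  rank : ℕ
  spectral : ∀ x : J, ∃ (c : Fin rank → J) (lam : Fin rank → ℝ),
    toJordanData.IsFrame c ∧ x = ∑ j, lam j • c j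
  tr_prim : ∀ c : J, toJordanData.IsPrimitive c → tr c = 1
  jdet : J → ℝ
  jdet_frame : ∀ (c : Fin rank → J) (lam : Fin rank → ℝ),
    toJordanData.IsFrame c → jdet (∑ j, lam j • c j) = ∏ j, lam j

namespace EJA

variable {J : Type} [NormedAddCommGroup J] [NormedSpace ℝ J] [FiniteDimensional ℝ J]

def IsIdem (A : EJA J) (c : J) : Prop := A.toJordanData.IsIdem c

def IsPrimitive (A : EJA J) (c : J) : Prop := A.toJordanData.IsPrimitive c

def IsFrame (A : EJA J) {m : ℕ} (c : Fin m → J) : Prop := A.toJordanData.IsFrame c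

/-- `x` has rank `k`: in a spectral decomposition of `x`, exactly `k` eigenvalues are nonzero. -/
def HasRank (A : EJA J) (x : J) (k : ℕ) : Prop :=
  ∃ (c : Fin A.rank → J) (lam : Fin A.rank → ℝ), A.IsFrame c ∧
    x = ∑ j, lam j • c j ∧ (Finset.univ.filter fun j => lam j ≠ 0).card = k

/-- The symmetric cone `Ω`: the interior of the set of squares. -/
def cone (A : EJA J) : Set J := interior {x : J | ∃ y : J, x = A.mul y y}

/-- The Peirce space `J(c,t)`, i.e. the `t`-eigenspace of the multiplication operator `L(c)`. -/
def peirce (A : EJA J) (c : J) (t : ℝ) : Submodule ℝ J :=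
  LinearMap.ker (A.mul c - t • (LinearMap.id : J →ₗ[ℝ] J))

/-- The symmetric cone of the Jordan subalgebra `J(c,t)` (`t = 1` or `t = 0`):
the relative interior, within `J(c,t)`, of the set of squares of elements of `J(c,t)`. -/
def subCone (A : EJA J) (c : J) (t : ℝ) : Set J :=
  {x : J | x ∈ A.peirce c t ∧ ∃ U : Set J, IsOpen U ∧ x ∈ U ∧
    ∀ y ∈ U, y ∈ A.peirce c t → ∃ w ∈ A.peirce c t, y = A.mul w w}

/-- Powers in the Jordan algebra, with `x ^ 0 = e`. -/
def pow (A : EJA J) (x : J) : ℕ → J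
  | 0 => A.e
  | n + 1 => A.mul x (A.pow x n)

/-- `y` is the Jordan inverse of `x`: `y` lies in the subalgebra `ℝ[x]` and `x·y = e`. -/
def IsInverse (A : EJA J) (x y : J) : Prop :=
  y ∈ Submodule.span ℝ (Set.range (A.pow x)) ∧ A.mul x y = A.e

/-- The set of invertible linear maps preserving the symmetric cone. -/
def conePreserving (A : EJA J) : Set (J →L[ℝ] J)ˣ :=
  {g | (g : J →L[ℝ] J) '' A.cone = A.cone}

theorem one_mem_conePreserving (A : EJA J) : 1 ∈ A.conePreserving := by
  show (↑(1 : (J →L[ℝ] J)ˣ) : J →L[ℝ] J) '' A.cone = A.cone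
  simp

/-- The group `L`: the identity component of the group of linear transformations of `J`
preserving the symmetric cone `Ω`. -/
def Lgroup (A : EJA J) : Set (J →L[ℝ] J)ˣ :=
  {g | ∃ h : g ∈ A.conePreserving,
    (⟨g, h⟩ : A.conePreserving) ∈ connectedComponent ⟨1, A.one_mem_conePreserving⟩}

end EJA

namespace EJA

section Helpers

variable {J : Type} [NormedAddCommGroup J] [NormedSpace ℝ J] [FiniteDimensional ℝ J]

theorem frame_idem_mul (A : EJA J) {m : ℕ} {c : Fin m → J} (hc : A.IsFrame c) (b : Fin m → ℝ)
    (i : Fin m) : A.mul (c i) (∑ j, b j • c j) = b i • c i := by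
  rw [map_sum, Finset.sum_eq_single i]
  · rw [map_smul]
    have h : A.mul (c i) (c i) = c i := (hc.1 i).1
    rw [h]
  · intro j _ hj
    rw [map_smul, hc.2.1 i j hj.symm, smul_zero]
  · simp

theorem frame_mul (A : EJA J) {m : ℕ} {c : Fin m → J} (hc : A.IsFrame c) (a b : Fin m → ℝ) :
    A.mul (∑ j, a j • c j) (∑ j, b j • c j) = ∑ j, (a j * b j) • c j := by
  rw [map_sum A.mul, LinearMap.sum_apply]
  refine Finset.sum_congr rfl fun i _ => ?_
  rw [map_smul, LinearMap.smul_apply, A.frame_idem_mul hc, smul_smul]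

theorem frame_pow (A : EJA J) {m : ℕ} {c : Fin m → J} (hc : A.IsFrame c) (a : Fin m → ℝ) (n : ℕ) :
    A.pow (∑ j, a j • c j) n = ∑ j, (a j ^ n) • c j := by
  induction n with
  | zero => simpa [EJA.pow] using hc.2.2.symm
  | succ n ih =>
    rw [EJA.pow, ih, A.frame_mul hc]
    simp only [pow_succ']

theorem tr_idem (A : EJA J) {c : J} {k : ℕ} (hc : A.IsIdem c) (hr : A.HasRank c k) :
    A.tr c = k := by
  obtain ⟨d, mu, hd, rfl, rfl⟩ := hr
  have h1 : ∀ i, mu i = if mu i ≠ 0 then 1 else 0 := by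
    intro i
    have h2 : A.mul (∑ j, mu j • d j) (∑ j, mu j • d j) = ∑ j, mu j • d j := hc
    rw [A.frame_mul hd] at h2
    have h3 := congrArg (A.mul (d i)) h2
    rw [A.frame_idem_mul hd, A.frame_idem_mul hd] at h3
    have h4 := smul_left_injective ℝ (hd.1 i).2.1 h3
    split_ifs with h
    · exact mul_left_cancel₀ h (by simpa using h4)
    · simpa using h
  rw [map_sum, Finset.card_filter]
  push_cast
  refine Finset.sum_congr rfl fun i _ => ?_
  rw [map_smul, A.tr_prim _ (hd.1 i), smul_eq_mul, mul_one]
  exact h1 i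

theorem op_commute (A : EJA J) {c x : J} (hc : A.IsIdem c) (h : A.mul c x = x) (y : J) :
    A.mul c (A.mul x y) = A.mul x (A.mul c y) := by
  have hc' : A.mul c c = c := hc
  have h' : A.mul x c = x := by rw [A.comm, h]
  have e1 := A.jordan (c + x) y
  have e2 := A.jordan (c - x) y
  have e3 := A.jordan x y
  simp only [map_add, map_sub, LinearMap.add_apply, LinearMap.sub_apply, h, h', hc'] at e1 e2
  have : (2 : ℝ) • A.mul c (A.mul x y) = (2 : ℝ) • A.mul x (A.mul c y) := by
    linear_combination (norm := module) (-1 : ℝ) • e1 + e2 + (2 : ℝ) • e3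
  exact smul_right_injective J (two_ne_zero) this

theorem mul_pow_succ (A : EJA J) {c x : J} (hc : A.IsIdem c) (h : A.mul c x = x) (n : ℕ) :
    A.mul c (A.pow x (n + 1)) = A.pow x (n + 1) := by
  induction n with
  | zero => simp only [EJA.pow]; rw [A.comm x, A.unit_mul, h]
  | succ n ih => rw [EJA.pow, A.op_commute hc h, ih]

/-- The support idempotent is a polynomial without constant term in `x`. -/
theorem support_poly (A : EJA J) {m : ℕ} {c : Fin m → J} (hc : A.IsFrame c) (a : Fin m → ℝ) :
    ∃ q : Polynomial ℝ, ∑ j, (a j * (a j)⁻¹) • c j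
      = ∑ n ∈ Finset.range (q.natDegree + 1), q.coeff n • A.pow (∑ j, a j • c j) (n + 1) := by
  refine ⟨Lagrange.interpolate (Finset.univ.image a) id (fun t => t⁻¹), ?_⟩
  set q := Lagrange.interpolate (Finset.univ.image a) id (fun t : ℝ => t⁻¹) with hq
  have hev : ∀ j, q.eval (a j) = (a j)⁻¹ := fun j =>
    Lagrange.eval_interpolate_at_node (s := Finset.univ.image a) (v := id) (fun t : ℝ => t⁻¹)
      Function.injective_id.injOn (Finset.mem_image_of_mem a (Finset.mem_univ j))
  simp only [A.frame_pow hc, Finset.smul_sum, smul_smul]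
  rw [Finset.sum_comm]
  refine Finset.sum_congr rfl fun j _ => ?_
  rw [← Finset.sum_smul, ← hev j, Polynomial.eval_eq_sum_range, Finset.mul_sum]
  congr 1
  refine Finset.sum_congr rfl fun n _ => ?_
  ring

end Helpers

end EJA

/-- Let `x ∈ J` be an element of rank `k`.  There is a unique idempotent
`c` of rank `k` such that `c·x = x`; moreover this idempotent belongs to the subalgebra
`ℝ[x]` generated by `x`. -/
theorem EJA.exists_unique_support_idempotent {J : Type} [NormedAddCommGroup J]
    [NormedSpace ℝ J] [FiniteDimensional ℝ J] (A : EJA J) (x : J) (k : ℕ)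
    (hx : A.HasRank x k) :
    (∃! c : J, A.IsIdem c ∧ A.HasRank c k ∧ A.mul c x = x) ∧
    ∀ c : J, A.IsIdem c → A.HasRank c k → A.mul c x = x →
      c ∈ Submodule.span ℝ (Set.range (A.pow x)) := by
  obtain ⟨d, lam, hd, rfl, hk⟩ := hx
  obtain ⟨q, hq⟩ := A.support_poly hd lam
  set x := ∑ j, lam j • d j with hxdef
  set s := ∑ j, (lam j * (lam j)⁻¹) • d j with hs
  have hsid : A.mul s s = s := by
    rw [hs, A.frame_mul hd]
    refine Finset.sum_congr rfl fun j _ => ?_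
    congr 1
    by_cases h : lam j = 0 <;> simp [h]
  have hsx : A.mul s x = x := by
    rw [hs, hxdef, A.frame_mul hd]
    refine Finset.sum_congr rfl fun j _ => ?_
    congr 1
    by_cases h : lam j = 0 <;> simp [h]
  have hsr : A.HasRank s k := by
    refine ⟨d, fun j => lam j * (lam j)⁻¹, hd, rfl, ?_⟩
    rw [← hk]
    congr 1
    ext j
    simp
  have hspan : s ∈ Submodule.span ℝ (Set.range (A.pow x)) := by
    rw [hq]
    exact Submodule.sum_mem _ fun n _ => Submodule.smul_mem _ _ (Submodule.subset_span ⟨n + 1, rfl⟩)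
  have huniq : ∀ c : J, A.IsIdem c → A.HasRank c k → A.mul c x = x → c = s := by
    intro c hc hr hcx
    have hcs : A.mul c s = s := by
      rw [hq, map_sum]
      refine Finset.sum_congr rfl fun n _ => ?_
      rw [map_smul, A.mul_pow_succ hc hcx]
    have hsc : A.mul s c = s := by rw [A.comm, hcs]
    have hcc : A.mul c c = c := hc
    have hsq : A.mul (c - s) (c - s) = c - s := by
      simp [hcs, hsc, hcc, hsid]
    by_contra hne
    have hpos := A.tr_posdef (c - s) (sub_ne_zero.mpr hne)
    rw [hsq, map_sub, A.tr_idem hc hr, A.tr_idem hsid hsr] at hpos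
    simp at hpos
  refine ⟨⟨s, ⟨hsid, hsr, hsx⟩, fun c hc => huniq c hc.1 hc.2.1 hc.2.2⟩, ?_⟩
  intro c hc hr hcx
  rw [huniq c hc hr hcx]
  exact hspan
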